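/- Determinant of the mixed Hessian: let β ∈ ℝ, β ≠ 0, Φ(x,t) = (|x|⁴+t²)^{−β/4}, φ(x,t,y,s) = Φ((x,t)·(y,s)^{−1}), and let H(x,t,y,s) be the (2n+1)×(2n+1) matrix of mixed second derivatives (∂²φ/∂(y_j,s)∂(x_i,t)). Then there exist constants c_{a,β} ≠ 0 and m₁, m₂ ∈ ℝ such that for all (x,t),(y,s) with (x,t)·(y,s)^{−1} ≠ 0, det H(x,t,y,s) = F((x,t)·(y,s)^{−1}), where F(x,t) = c_{a,β} (|x|⁴ + a²t²)^{m₁} (|x|⁴ + t²)^{m₂} f_{a,β}(x,t) and f_{a,β}(x,t) = 2(β+1)|x|⁸ + (3(β+2) − 2a²)|x|⁴t² + (β+2)a²t⁴. -/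

import Mathlib

noncomputable section

/-- The standard `2n × 2n` block matrix `[[0, Iₙ],[−Iₙ, 0]]`. -/
def Jmat (n : ℕ) : Matrix (Fin (2*n)) (Fin (2*n)) ℝ :=
  Matrix.of fun i j =>
    if (i : ℕ) < n ∧ (j : ℕ) = (i : ℕ) + n then 1
    else if n ≤ (i : ℕ) ∧ (i : ℕ) = (j : ℕ) + n then -1 else 0

/-- Heisenberg group multiplication on `ℝ^{2n} × ℝ`. -/
def heisMul (n : ℕ) (a : ℝ) (p q : (Fin (2*n) → ℝ) × ℝ) : (Fin (2*n) → ℝ) × ℝ :=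
  (p.1 + q.1, q.2 + p.2 - 2 * a * ∑ i, ∑ j, p.1 i * Jmat n i j * q.1 j)

/-- Heisenberg group inverse `(x,t)⁻¹ = (−x,−t)`. -/
def heisInv (n : ℕ) (p : (Fin (2*n) → ℝ) × ℝ) : (Fin (2*n) → ℝ) × ℝ :=
  (-p.1, -p.2)

/-- `Φ(x,t) = (|x|⁴+t²)^{−β/4}`. -/
def PhiFun (n : ℕ) (β : ℝ) (p : (Fin (2*n) → ℝ) × ℝ) : ℝ :=
  ((∑ i, p.1 i ^ 2) ^ 2 + p.2 ^ 2) ^ (-β/4)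

/-- The `i`-th coordinate direction in `ℝ^{2n} × ℝ`, for `i : Fin (2n+1)`. -/
def coordDir (n : ℕ) (i : Fin (2*n+1)) : (Fin (2*n) → ℝ) × ℝ :=
  if h : (i : ℕ) < 2*n then (Pi.single (⟨i, h⟩ : Fin (2*n)) 1, 0) else (0, 1)

/-- The `(2n+1)×(2n+1)` mixed Hessian `H(x,t,y,s) = (∂²φ/∂(y_j,s)∂(x_i,t))` of
`φ(x,t,y,s) = Φ((x,t)·(y,s)⁻¹)`. -/
def mixedHess (n : ℕ) (a β : ℝ) (p q : (Fin (2*n) → ℝ) × ℝ) :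
    Matrix (Fin (2*n+1)) (Fin (2*n+1)) ℝ :=
  Matrix.of fun i j =>
    fderiv ℝ (fun p' =>
      fderiv ℝ (fun q' => PhiFun n β (heisMul n a p' (heisInv n q'))) q (coordDir n j))
      p (coordDir n i)

/-- `f_{a,β}(x,t) = 2(β+1)|x|⁸ + (3(β+2) − 2a²)|x|⁴t² + (β+2)a²t⁴`. -/
def fab (n : ℕ) (a β : ℝ) (p : (Fin (2*n) → ℝ) × ℝ) : ℝ :=
  2 * (β + 1) * (∑ i, p.1 i ^ 2) ^ 4
    + (3 * (β + 2) - 2 * a ^ 2) * (∑ i, p.1 i ^ 2) ^ 2 * p.2 ^ 2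
    + (β + 2) * a ^ 2 * p.2 ^ 4

open Matrix

theorem Jmat_reindex (n : ℕ) :
    (Jmat n).submatrix (finSumFinEquiv.trans (finCongr (two_mul n).symm))
      (finSumFinEquiv.trans (finCongr (two_mul n).symm)) = fromBlocks 0 1 (-1) 0 := by
  ext i j
  rcases i with i | i <;> rcases j with j | j <;>
    simp [Jmat, Matrix.one_apply, Fin.ext_iff] <;> grind

theorem det_smul_one_block {m : Type*} [Fintype m] [DecidableEq m] (r c : ℝ) :
    (fromBlocks (r • (1 : Matrix m m ℝ)) (c • (1 : Matrix m m ℝ))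
      (-c • (1 : Matrix m m ℝ)) (r • (1 : Matrix m m ℝ))).det
      = (r ^ 2 + c ^ 2) ^ Fintype.card m := by
  by_cases hr : r = 0
  · subst hr
    have h : fromBlocks (1 : Matrix m m ℝ) (-1 : Matrix m m ℝ) 0 1 *
        fromBlocks ((0 : ℝ) • (1 : Matrix m m ℝ)) (c • (1 : Matrix m m ℝ))
          (-c • (1 : Matrix m m ℝ)) ((0 : ℝ) • (1 : Matrix m m ℝ)) * fromBlocks 1 (-1) 0 1
        * fromBlocks 1 0 1 1
        = fromBlocks (c • (1 : Matrix m m ℝ)) 0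
          0 (c • (1 : Matrix m m ℝ)) := by
      simp [fromBlocks_multiply]
    have h2 := congrArg det h
    simp only [det_mul, det_fromBlocks_zero₂₁, det_fromBlocks_zero₁₂, det_smul, det_one, mul_one,
      one_mul] at h2
    rw [h2, ← mul_pow]
    ring_nf
  · have h : fromBlocks (r • (1 : Matrix m m ℝ)) (c • (1 : Matrix m m ℝ))
          (-c • (1 : Matrix m m ℝ)) (r • (1 : Matrix m m ℝ)) *
        fromBlocks (r • (1 : Matrix m m ℝ)) 0 (c • (1 : Matrix m m ℝ)) 1
        = fromBlocks ((r ^ 2 + c ^ 2) • (1 : Matrix m m ℝ)) (c • (1 : Matrix m m ℝ))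
          0 (r • (1 : Matrix m m ℝ)) := by
      simp [fromBlocks_multiply, smul_smul, ← add_smul]
      refine ⟨?_, ?_⟩
      · congr 1; ring
      · rw [mul_comm]; simp
    have h2 := congrArg det h
    rw [det_mul, det_fromBlocks_zero₂₁, det_fromBlocks_zero₁₂] at h2
    simp only [det_smul, det_one, mul_one] at h2
    exact mul_right_cancel₀ (pow_ne_zero _ hr) h2

theorem Jmat_transpose (n : ℕ) : (Jmat n)ᵀ = -Jmat n := by
  ext i j
  simp [Jmat]
  grind

theorem Jmat_mul_self (n : ℕ) : Jmat n * Jmat n = -1 := by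
  have h : ((Jmat n) * (Jmat n)).submatrix (finSumFinEquiv.trans (finCongr (two_mul n).symm))
      (finSumFinEquiv.trans (finCongr (two_mul n).symm)) =
      (-1 : Matrix _ _ ℝ).submatrix (finSumFinEquiv.trans (finCongr (two_mul n).symm))
      (finSumFinEquiv.trans (finCongr (two_mul n).symm)) := by
    rw [← submatrix_mul_equiv (e₂ := finSumFinEquiv.trans (finCongr (two_mul n).symm)),
      Jmat_reindex, fromBlocks_multiply, submatrix_neg, Pi.neg_apply, Pi.neg_apply,
      submatrix_one_equiv, ← fromBlocks_one, fromBlocks_neg]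
    simp
  exact (reindex (finSumFinEquiv.trans (finCongr (two_mul n).symm)).symm
    (finSumFinEquiv.trans (finCongr (two_mul n).symm)).symm).injective h

theorem det_smul_one_add_smul_Jmat (n : ℕ) (r c : ℝ) :
    (r • (1 : Matrix (Fin (2*n)) (Fin (2*n)) ℝ) + c • Jmat n).det = (r ^ 2 + c ^ 2) ^ n := by
  rw [← det_submatrix_equiv_self (finSumFinEquiv.trans (finCongr (two_mul n).symm)),
    submatrix_add, submatrix_smul, submatrix_smul]
  simp only [Pi.add_apply, Pi.smul_apply, Jmat_reindex, submatrix_one_equiv]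
  have := det_smul_one_block (m := Fin n) r c
  rw [Fintype.card_fin] at this
  rw [← this, ← fromBlocks_one, fromBlocks_smul, fromBlocks_smul, fromBlocks_add]
  simp

theorem dotProduct_Jmat_mulVec_self (n : ℕ) (z : Fin (2*n) → ℝ) : z ⬝ᵥ Jmat n *ᵥ z = 0 := by
  have h : z ⬝ᵥ Jmat n *ᵥ z = -(z ⬝ᵥ Jmat n *ᵥ z) := by
    conv_lhs => rw [dotProduct_mulVec, ← mulVec_transpose, Jmat_transpose, dotProduct_comm]
    simp [neg_mulVec]
  linarith

theorem det_fromBlocks_smul_one (p q r s : ℝ) :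
    (fromBlocks (p • (1 : Matrix (Fin 1) (Fin 1) ℝ)) (q • (1 : Matrix (Fin 1) (Fin 1) ℝ))
      (r • (1 : Matrix (Fin 1) (Fin 1) ℝ)) (s • (1 : Matrix (Fin 1) (Fin 1) ℝ))).det
      = p * s - q * r := by
  rw [← det_submatrix_equiv_self (finSumFinEquiv (m := 1) (n := 1)).symm]
  refine (det_fin_two _).trans ?_
  have h0 : (finSumFinEquiv (m := 1) (n := 1)).symm 0 = Sum.inl 0 := rfl
  have h1 : (finSumFinEquiv (m := 1) (n := 1)).symm 1 = Sum.inr 0 := rfl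
  simp [h0, h1]

theorem det_bordered {m : Type*} [Fintype m] [DecidableEq m] (A S : Matrix m m ℝ)
    (hA : A * S = 1) (z : m → ℝ) (b d e : ℝ) :
    (fromBlocks (A + b • vecMulVec z z) (d • replicateCol (Fin 1) z)
      (d • replicateRow (Fin 1) z) (e • (1 : Matrix (Fin 1) (Fin 1) ℝ))).det
      = A.det * (e + (b * e - d ^ 2) * (z ⬝ᵥ S *ᵥ z)) := by
  have hD : fromBlocks A 0 0 (1 : Matrix (Fin 1) (Fin 1) ℝ) * fromBlocks S 0 0 1 = 1 := by
    simp [fromBlocks_multiply, hA]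
  have hdec : fromBlocks (A + b • vecMulVec z z) (d • replicateCol (Fin 1) z)
      (d • replicateRow (Fin 1) z) (e • (1 : Matrix (Fin 1) (Fin 1) ℝ))
      = fromBlocks A 0 0 (1 : Matrix (Fin 1) (Fin 1) ℝ) +
        fromBlocks (replicateCol (Fin 1) z) 0 0 (1 : Matrix (Fin 1) (Fin 1) ℝ) *
        fromBlocks (b • replicateRow (Fin 1) z) (d • (1 : Matrix (Fin 1) (Fin 1) ℝ))
          (d • replicateRow (Fin 1) z) ((e - 1) • (1 : Matrix (Fin 1) (Fin 1) ℝ)) := by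
    have hv : vecMulVec z z = replicateCol (Fin 1) z * replicateRow (Fin 1) z := by
      ext
      simp [vecMulVec_apply, Matrix.mul_apply]
    simp [fromBlocks_multiply, fromBlocks_add, hv, sub_smul]
  have hu : IsUnit (fromBlocks A 0 0 (1 : Matrix (Fin 1) (Fin 1) ℝ)).det :=
    isUnit_det_of_right_inverse hD
  rw [hdec, det_add_mul _ _ hu, inv_eq_right_inv hD]
  have hk : replicateRow (Fin 1) z * S * replicateCol (Fin 1) z
      = (z ⬝ᵥ S *ᵥ z) • (1 : Matrix (Fin 1) (Fin 1) ℝ) := by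
    ext i j
    fin_cases i; fin_cases j
    simp only [Matrix.mul_apply, dotProduct, mulVec, Finset.sum_mul, Finset.mul_sum]
    rw [Finset.sum_comm]
    simp [mul_assoc]
  rw [det_fromBlocks_zero₂₁, det_one, mul_one]
  congr 1
  have h1 : (1 : Matrix (Fin 1 ⊕ Fin 1) (Fin 1 ⊕ Fin 1) ℝ) +
      fromBlocks (b • replicateRow (Fin 1) z) (d • (1 : Matrix (Fin 1) (Fin 1) ℝ))
          (d • replicateRow (Fin 1) z) ((e - 1) • (1 : Matrix (Fin 1) (Fin 1) ℝ)) *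
        fromBlocks S 0 0 (1 : Matrix (Fin 1) (Fin 1) ℝ) *
          fromBlocks (replicateCol (Fin 1) z) 0 0 (1 : Matrix (Fin 1) (Fin 1) ℝ)
      = fromBlocks ((1 + b * (z ⬝ᵥ S *ᵥ z)) • 1) (d • 1) ((d * (z ⬝ᵥ S *ᵥ z)) • 1) (e • 1) := by
    simp [fromBlocks_multiply, ← fromBlocks_one, fromBlocks_add, hk, add_smul, sub_smul, mul_smul]
  rw [h1, det_fromBlocks_smul_one]
  ring

/-- The vertical component of `p · q⁻¹`. -/
def vert (n : ℕ) (a : ℝ) (p q : (Fin (2*n) → ℝ) × ℝ) : ℝ :=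
  p.2 - q.2 + 2 * a * (p.1 ⬝ᵥ Jmat n *ᵥ q.1)

/-- The fourth power of the Korányi norm of `p · q⁻¹`. -/
def koranyi (n : ℕ) (a : ℝ) (p q : (Fin (2*n) → ℝ) × ℝ) : ℝ :=
  ((p.1 - q.1) ⬝ᵥ (p.1 - q.1)) ^ 2 + vert n a p q ^ 2

theorem heisMul_heisInv (n : ℕ) (a : ℝ) (p q : (Fin (2*n) → ℝ) × ℝ) :
    heisMul n a p (heisInv n q) = (p.1 - q.1, vert n a p q) := by
  ext
  · simp [heisMul, heisInv, sub_eq_add_neg]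
  · simp [heisMul, heisInv, vert, dotProduct, mulVec, Finset.mul_sum, mul_assoc]
    ring

theorem PhiFun_heisMul_heisInv (n : ℕ) (a β : ℝ) (p q : (Fin (2*n) → ℝ) × ℝ) :
    PhiFun n β (heisMul n a p (heisInv n q)) = koranyi n a p q ^ (-β/4) := by
  rw [heisMul_heisInv]
  simp [PhiFun, koranyi, dotProduct, sq]

theorem koranyi_pos {n : ℕ} {a : ℝ} {p q : (Fin (2*n) → ℝ) × ℝ}
    (h : heisMul n a p (heisInv n q) ≠ (0, 0)) : 0 < koranyi n a p q := by
  rw [heisMul_heisInv] at h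
  unfold koranyi
  by_contra hc
  have h1 := sq_nonneg ((p.1 - q.1) ⬝ᵥ (p.1 - q.1))
  have h2 := sq_nonneg (vert n a p q)
  apply h
  have h3 : (p.1 - q.1) ⬝ᵥ (p.1 - q.1) = 0 := pow_eq_zero_iff two_ne_zero |>.1 (by linarith)
  have h4 : vert n a p q = 0 := pow_eq_zero_iff two_ne_zero |>.1 (by linarith)
  rw [h4, dotProduct_self_eq_zero.1 h3]

theorem differentiable_vert_left (n : ℕ) (a : ℝ) (q : (Fin (2*n) → ℝ) × ℝ) :
    Differentiable ℝ (fun p => vert n a p q) := by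
  unfold vert dotProduct
  fun_prop

theorem differentiable_koranyi_left (n : ℕ) (a : ℝ) (q : (Fin (2*n) → ℝ) × ℝ) :
    Differentiable ℝ (fun p => koranyi n a p q) := by
  have := differentiable_vert_left n a q
  unfold koranyi dotProduct
  fun_prop

theorem differentiable_koranyi_right (n : ℕ) (a : ℝ) (p : (Fin (2*n) → ℝ) × ℝ) :
    Differentiable ℝ (fun q => koranyi n a p q) := by
  unfold koranyi vert dotProduct mulVec dotProduct
  fun_prop

theorem vert_add_smul_right (n : ℕ) (a t : ℝ) (p q v : (Fin (2*n) → ℝ) × ℝ) :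
    vert n a p (q + t • v) = vert n a p q + t * (2 * a * (p.1 ⬝ᵥ Jmat n *ᵥ v.1) - v.2) := by
  simp [vert, mulVec_add, mulVec_smul]
  ring

theorem vert_add_smul_left (n : ℕ) (a t : ℝ) (p q v : (Fin (2*n) → ℝ) × ℝ) :
    vert n a (p + t • v) q = vert n a p q + t * (2 * a * (v.1 ⬝ᵥ Jmat n *ᵥ q.1) + v.2) := by
  simp [vert]
  ring

theorem koranyi_add_smul_right (n : ℕ) (a t : ℝ) (p q v : (Fin (2*n) → ℝ) × ℝ) :
    koranyi n a p (q + t • v) =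
      ((p.1 - q.1) ⬝ᵥ (p.1 - q.1) - 2 * t * ((p.1 - q.1) ⬝ᵥ v.1) + t ^ 2 * (v.1 ⬝ᵥ v.1)) ^ 2
      + (vert n a p q + t * (2 * a * (p.1 ⬝ᵥ Jmat n *ᵥ v.1) - v.2)) ^ 2 := by
  rw [koranyi, vert_add_smul_right]
  have h : p.1 - (q + t • v).1 = (p.1 - q.1) - t • v.1 := by simp [sub_sub]
  rw [h]
  generalize p.1 - q.1 = z
  rw [sub_dotProduct, dotProduct_sub, dotProduct_sub, dotProduct_smul, smul_dotProduct,
    smul_dotProduct, dotProduct_smul, dotProduct_comm v.1 z]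
  simp only [smul_eq_mul]
  ring

theorem koranyi_add_smul_left (n : ℕ) (a t : ℝ) (p q v : (Fin (2*n) → ℝ) × ℝ) :
    koranyi n a (p + t • v) q =
      ((p.1 - q.1) ⬝ᵥ (p.1 - q.1) + 2 * t * ((p.1 - q.1) ⬝ᵥ v.1) + t ^ 2 * (v.1 ⬝ᵥ v.1)) ^ 2
      + (vert n a p q + t * (2 * a * (v.1 ⬝ᵥ Jmat n *ᵥ q.1) + v.2)) ^ 2 := by
  rw [koranyi, vert_add_smul_left]
  have h : (p + t • v).1 - q.1 = (p.1 - q.1) + t • v.1 := by simp; abel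
  rw [h]
  generalize p.1 - q.1 = z
  rw [add_dotProduct, dotProduct_add, dotProduct_add, dotProduct_smul, smul_dotProduct,
    smul_dotProduct, dotProduct_smul, dotProduct_comm v.1 z]
  simp only [smul_eq_mul]
  ring

theorem hasDerivAt_quartic (r b c w d : ℝ) :
    HasDerivAt (fun t : ℝ => (r + 2 * t * b + t ^ 2 * c) ^ 2 + (w + t * d) ^ 2)
      (4 * r * b + 2 * w * d) 0 := by
  have h1 : HasDerivAt (fun t : ℝ => r + 2 * t * b + t ^ 2 * c) (2 * b) 0 := by
    have := ((((hasDerivAt_id (0 : ℝ)).const_mul 2).mul_const b).const_add r).add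
      (((hasDerivAt_id (0 : ℝ)).pow 2).mul_const c)
    convert! this using 1
    simp
  have h2 : HasDerivAt (fun t : ℝ => w + t * d) d 0 := by
    simpa using ((hasDerivAt_id (0 : ℝ)).mul_const d).const_add w
  convert! (h1.pow 2).add (h2.pow 2) using 1
  simp
  ring

/-- Derivative of `koranyi` in the second variable. -/
def koranyiDeriv (n : ℕ) (a : ℝ) (p q v : (Fin (2*n) → ℝ) × ℝ) : ℝ :=
  -4 * ((p.1 - q.1) ⬝ᵥ (p.1 - q.1)) * ((p.1 - q.1) ⬝ᵥ v.1)
    + 2 * vert n a p q * (2 * a * (p.1 ⬝ᵥ Jmat n *ᵥ v.1) - v.2)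

theorem fderiv_koranyi_rpow_right (n : ℕ) (a γ : ℝ) (p q v : (Fin (2*n) → ℝ) × ℝ)
    (h : koranyi n a p q ≠ 0) :
    fderiv ℝ (fun q' => koranyi n a p q' ^ γ) q v
      = γ * (koranyi n a p q ^ (γ - 1) * koranyiDeriv n a p q v) := by
  have hd : DifferentiableAt ℝ (fun q' => koranyi n a p q' ^ γ) q :=
    (differentiable_koranyi_right n a p q).rpow_const (Or.inl h)
  rw [← hd.lineDeriv_eq_fderiv]
  apply HasLineDerivAt.lineDeriv
  unfold HasLineDerivAt
  have h1 : HasDerivAt (fun t : ℝ => koranyi n a p (q + t • v)) (koranyiDeriv n a p q v) 0 := by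
    simp only [koranyi_add_smul_right]
    convert! hasDerivAt_quartic ((p.1 - q.1) ⬝ᵥ (p.1 - q.1)) (-((p.1 - q.1) ⬝ᵥ v.1))
      (v.1 ⬝ᵥ v.1) (vert n a p q) (2 * a * (p.1 ⬝ᵥ Jmat n *ᵥ v.1) - v.2) using 1
    · ext t; ring
    · rw [koranyiDeriv]; ring
  convert! h1.rpow_const (p := γ) (Or.inl (by simpa using h)) using 1
  simp
  ring

theorem fderiv_fderiv_koranyi_rpow (n : ℕ) (a γ : ℝ) (p q v e : (Fin (2*n) → ℝ) × ℝ)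
    (h : 0 < koranyi n a p q) :
    fderiv ℝ (fun p' => fderiv ℝ (fun q' => koranyi n a p' q' ^ γ) q v) p e
      = γ * koranyi n a p q ^ (γ - 2) *
        ((γ - 1) * (4 * ((p.1 - q.1) ⬝ᵥ (p.1 - q.1)) * ((p.1 - q.1) ⬝ᵥ e.1)
            + 2 * vert n a p q * (2 * a * (e.1 ⬝ᵥ Jmat n *ᵥ q.1) + e.2))
          * koranyiDeriv n a p q v
        + koranyi n a p q * (-8 * ((p.1 - q.1) ⬝ᵥ e.1) * ((p.1 - q.1) ⬝ᵥ v.1)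
            - 4 * ((p.1 - q.1) ⬝ᵥ (p.1 - q.1)) * (e.1 ⬝ᵥ v.1)
            + 2 * (2 * a * (e.1 ⬝ᵥ Jmat n *ᵥ q.1) + e.2) * (2 * a * (p.1 ⬝ᵥ Jmat n *ᵥ v.1) - v.2)
            + 4 * a * vert n a p q * (e.1 ⬝ᵥ Jmat n *ᵥ v.1))) := by
  have hev : (fun p' => fderiv ℝ (fun q' => koranyi n a p' q' ^ γ) q v) =ᶠ[nhds p]
      fun p' => γ * (koranyi n a p' q ^ (γ - 1) * koranyiDeriv n a p' q v) := by
    filter_upwards [(differentiable_koranyi_left n a q).continuous.continuousAt.eventually_ne h.ne']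
      with p' hp' using fderiv_koranyi_rpow_right n a γ p' q v hp'
  have hd : DifferentiableAt ℝ
      (fun p' => γ * (koranyi n a p' q ^ (γ - 1) * koranyiDeriv n a p' q v)) p := by
    have h1 : DifferentiableAt ℝ (fun p' => koranyi n a p' q ^ (γ - 1)) p :=
      (differentiable_koranyi_left n a q p).rpow_const (Or.inl h.ne')
    have h2 : Differentiable ℝ (fun p' => koranyiDeriv n a p' q v) := by
      have := differentiable_vert_left n a q
      unfold koranyiDeriv dotProduct
      fun_prop
    fun_prop
  rw [hev.fderiv_eq, ← hd.lineDeriv_eq_fderiv]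
  apply HasLineDerivAt.lineDeriv
  unfold HasLineDerivAt
  have h1 : HasDerivAt (fun t : ℝ => koranyi n a (p + t • e) q)
      (4 * ((p.1 - q.1) ⬝ᵥ (p.1 - q.1)) * ((p.1 - q.1) ⬝ᵥ e.1)
            + 2 * vert n a p q * (2 * a * (e.1 ⬝ᵥ Jmat n *ᵥ q.1) + e.2)) 0 := by
    simp only [koranyi_add_smul_left]
    exact hasDerivAt_quartic _ _ _ _ _
  have h2 : HasDerivAt (fun t : ℝ => koranyiDeriv n a (p + t • e) q v)
      (-8 * ((p.1 - q.1) ⬝ᵥ e.1) * ((p.1 - q.1) ⬝ᵥ v.1)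
            - 4 * ((p.1 - q.1) ⬝ᵥ (p.1 - q.1)) * (e.1 ⬝ᵥ v.1)
            + 2 * (2 * a * (e.1 ⬝ᵥ Jmat n *ᵥ q.1) + e.2) * (2 * a * (p.1 ⬝ᵥ Jmat n *ᵥ v.1) - v.2)
            + 4 * a * vert n a p q * (e.1 ⬝ᵥ Jmat n *ᵥ v.1)) 0 := by
    have hz : ∀ t : ℝ, (p + t • e).1 - q.1 = (p.1 - q.1) + t • e.1 := fun t => by simp; abel
    have hp : ∀ t : ℝ, (p + t • e).1 = p.1 + t • e.1 := fun t => rfl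
    simp only [koranyiDeriv, vert_add_smul_left, hz]
    generalize p.1 - q.1 = z
    simp only [hp, add_dotProduct, dotProduct_add,
      dotProduct_smul, smul_dotProduct, dotProduct_comm e.1 z, smul_eq_mul]
    have lin : ∀ b c : ℝ, HasDerivAt (fun t : ℝ => b + t * c) c 0 := fun b c => by
      simpa using ((hasDerivAt_id (0 : ℝ)).mul_const c).const_add b
    convert! ((((lin (z ⬝ᵥ z) (z ⬝ᵥ e.1)).add
      (((hasDerivAt_id (0 : ℝ)).mul
        (lin (z ⬝ᵥ e.1) (e.1 ⬝ᵥ e.1))))).const_mul (-4)).mul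
      (lin (z ⬝ᵥ v.1) (e.1 ⬝ᵥ v.1))).add
      (((lin (vert n a p q) (2 * a * (e.1 ⬝ᵥ Jmat n *ᵥ q.1) + e.2)).const_mul 2).mul
      (((lin (p.1 ⬝ᵥ Jmat n *ᵥ v.1) (e.1 ⬝ᵥ Jmat n *ᵥ v.1)).const_mul (2 * a)).sub_const v.2))
      using 1
    simp
    ring
  have h3 := ((h1.rpow_const (p := γ - 1) (Or.inl (by simpa using h.ne'))).mul h2).const_mul γ
  convert! h3 using 1
  have h4 : koranyi n a p q ^ (γ - 1) = koranyi n a p q ^ (γ - 2) * koranyi n a p q := by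
    rw [← Real.rpow_add_one h.ne']; congr 1; ring
  have h5 : γ - 1 - 1 = γ - 2 := by ring
  simp only [h5, zero_smul, add_zero, h4]
  ring

/-- The mixed Hessian of `koranyi ^ γ` where `p · q⁻¹ = (z, w)`, up to a scalar and left and
right unipotent factors. -/
def centralHess (n : ℕ) (a γ : ℝ) (z : Fin (2*n) → ℝ) (w : ℝ) :
    Matrix (Fin (2*n) ⊕ Fin 1) (Fin (2*n) ⊕ Fin 1) ℝ :=
  let r := z ⬝ᵥ z
  let u := r ^ 2 + w ^ 2
  fromBlocks
    ((4 * u) • (r • (1 : Matrix (Fin (2*n)) (Fin (2*n)) ℝ) + (-(a * w)) • Jmat n)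
      + (8 * u + 16 * (γ - 1) * r ^ 2) • vecMulVec z z)
    ((8 * (γ - 1) * r * w) • replicateCol (Fin 1) z)
    ((8 * (γ - 1) * r * w) • replicateRow (Fin 1) z)
    ((2 * u + 4 * (γ - 1) * w ^ 2) • (1 : Matrix (Fin 1) (Fin 1) ℝ))

theorem det_centralHess (n : ℕ) (hn : 1 ≤ n) (a γ : ℝ) (z : Fin (2*n) → ℝ) (w : ℝ)
    (h : 0 < (z ⬝ᵥ z) ^ 2 + w ^ 2) (ha : a ≠ 0) :
    (centralHess n a γ z w).det = -16 ^ n * ((z ⬝ᵥ z) ^ 2 + a ^ 2 * w ^ 2) ^ (n - 1)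
      * ((z ⬝ᵥ z) ^ 2 + w ^ 2) ^ (2 * n)
      * (2 * (-4 * γ + 1) * (z ⬝ᵥ z) ^ 4
        + (3 * (-4 * γ + 2) - 2 * a ^ 2) * (z ⬝ᵥ z) ^ 2 * w ^ 2
        + (-4 * γ + 2) * a ^ 2 * w ^ 4) := by
  obtain ⟨m, rfl⟩ : ∃ m, n = m + 1 := ⟨n - 1, by omega⟩
  unfold centralHess
  set r := z ⬝ᵥ z with hr
  set u := r ^ 2 + w ^ 2 with hu
  have hv : 0 < r ^ 2 + a ^ 2 * w ^ 2 := by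
    rcases eq_or_ne w 0 with rfl | hw
    · simpa [hu] using h
    · positivity
  set v := r ^ 2 + a ^ 2 * w ^ 2 with hv'
  have hS : ((4 * u) • (r • (1 : Matrix (Fin (2*(m+1))) (Fin (2*(m+1))) ℝ)
      + (-(a * w)) • Jmat (m+1))) *
      ((4 * u * v)⁻¹ • (r • (1 : Matrix (Fin (2*(m+1))) (Fin (2*(m+1))) ℝ)
        + (a * w) • Jmat (m+1))) = 1 := by
    have h1 : (r • (1 : Matrix (Fin (2*(m+1))) (Fin (2*(m+1))) ℝ) + (-(a * w)) • Jmat (m+1)) *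
        (r • (1 : Matrix (Fin (2*(m+1))) (Fin (2*(m+1))) ℝ) + (a * w) • Jmat (m+1)) = v • 1 := by
      simp only [add_mul, mul_add, smul_mul_assoc, mul_smul_comm, Jmat_mul_self, one_mul, mul_one]
      rw [hv']
      module
    rw [smul_mul_smul_comm, h1, smul_smul]
    rw [show 4 * u * (4 * u * v)⁻¹ * v = 1 by field_simp, one_smul]
  have hz : z ⬝ᵥ ((4 * u * v)⁻¹ • (r • (1 : Matrix (Fin (2*(m+1))) (Fin (2*(m+1))) ℝ)
        + (a * w) • Jmat (m+1))) *ᵥ z = (4 * u * v)⁻¹ * r ^ 2 := by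
    simp only [smul_mulVec, add_mulVec, one_mulVec, dotProduct_smul, dotProduct_add,
      dotProduct_Jmat_mulVec_self, ← hr, smul_eq_mul]
    ring
  rw [det_bordered _ _ hS, hz, det_smul, det_smul_one_add_smul_Jmat, Fintype.card_fin]
  rw [show r ^ 2 + (-(a * w)) ^ 2 = v by rw [hv']; ring, show m + 1 - 1 = m by omega]
  have hk : 2 * u + 4 * (γ - 1) * w ^ 2 + ((8 * u + 16 * (γ - 1) * r ^ 2) *
      (2 * u + 4 * (γ - 1) * w ^ 2) - (8 * (γ - 1) * r * w) ^ 2) * ((4 * u * v)⁻¹ * r ^ 2)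
      = -v⁻¹ * (2 * (-4 * γ + 1) * r ^ 4 + (3 * (-4 * γ + 2) - 2 * a ^ 2) * r ^ 2 * w ^ 2
        + (-4 * γ + 2) * a ^ 2 * w ^ 4) := by
    field_simp
    rw [hv', hu]
    ring
  rw [hk, pow_succ v, mul_pow, pow_mul 4 2]
  norm_num only
  field_simp

theorem coordDir_inl (n : ℕ) (i : Fin (2*n)) :
    coordDir n (finSumFinEquiv (Sum.inl i)) = (Pi.single i 1, 0) := by
  simp [coordDir]

theorem coordDir_inr (n : ℕ) (i : Fin 1) :
    coordDir n (finSumFinEquiv (Sum.inr i)) = (0, 1) := by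
  simp [coordDir]

theorem mixedHess_apply (n : ℕ) (a β : ℝ) (p q : (Fin (2*n) → ℝ) × ℝ) (i j : Fin (2*n+1)) :
    mixedHess n a β p q i j = fderiv ℝ (fun p' =>
      fderiv ℝ (fun q' => koranyi n a p' q' ^ (-β/4)) q (coordDir n j)) p (coordDir n i) := by
  simp [mixedHess, PhiFun_heisMul_heisInv]

theorem mixedHess_submatrix (n : ℕ) (a β : ℝ) (p q : (Fin (2*n) → ℝ) × ℝ)
    (h : 0 < koranyi n a p q) :
    (mixedHess n a β p q).submatrix finSumFinEquiv finSumFinEquiv =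
      (-(-β/4 * koranyi n a p q ^ (-β/4 - 2))) •
        (fromBlocks 1 (replicateCol (Fin 1) ((2 * a) • (Jmat n *ᵥ q.1))) 0 1
          * centralHess n a (-β/4) (p.1 - q.1) (vert n a p q)
          * fromBlocks 1 0 (replicateRow (Fin 1) (-(2 * a) • (p.1 ᵥ* Jmat n))) 1) := by
  ext i j
  rw [submatrix_apply, mixedHess_apply, fderiv_fderiv_koranyi_rpow n a _ p q _ _ h,
    Matrix.smul_apply, smul_eq_mul, neg_mul (-β/4 * _) ,
    ← mul_neg (-β/4 * _)]
  congr 1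
  generalize -β/4 = γ
  simp only [centralHess, fromBlocks_multiply]
  rw [← koranyi]
  unfold koranyiDeriv
  generalize vert n a p q = w
  generalize koranyi n a p q = u
  generalize p.1 - q.1 = z
  have hx : ∀ j, p.1 ⬝ᵥ Jmat n *ᵥ Pi.single j 1 = (p.1 ᵥ* Jmat n) j := fun j => by
    rw [dotProduct_mulVec, dotProduct_single_one]
  have hy : ∀ i, Pi.single i 1 ⬝ᵥ Jmat n *ᵥ q.1 = (Jmat n *ᵥ q.1) i := fun i => by
    rw [single_one_dotProduct]
  have hJ : ∀ i j, Pi.single i 1 ⬝ᵥ Jmat n *ᵥ Pi.single j 1 = Jmat n i j := fun i j => by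
    rw [single_one_dotProduct, mulVec_single_one, col_apply]
  rcases i with i | i <;> rcases j with j | j <;>
    simp only [coordDir_inl, coordDir_inr, hx, hy, hJ]
  · simp [Matrix.mul_apply, vecMulVec_apply, Pi.single_apply, Matrix.one_apply, eq_comm]
    split_ifs <;> ring
  · rw [Subsingleton.elim j 0]
    simp
    ring
  · rw [Subsingleton.elim i 0]
    simp
    ring
  · rw [Subsingleton.elim j 0, Subsingleton.elim i 0]
    simp
    ring

/-- Determinant of the mixed Hessian: there are `c_{a,β} ≠ 0` and `m₁, m₂ ∈ ℝ` with
`det H(x,t,y,s) = c_{a,β} (|z|⁴+a²w²)^{m₁} (|z|⁴+w²)^{m₂} f_{a,β}(z,w)` where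
`(z,w) = (x,t)·(y,s)⁻¹`. -/
theorem mixedHess_det
    (n : ℕ) (hn : 1 ≤ n) (a : ℝ) (ha : a ≠ 0) (β : ℝ) (hβ : β ≠ 0) :
    ∃ c : ℝ, c ≠ 0 ∧ ∃ m₁ m₂ : ℝ,
      ∀ p q : (Fin (2*n) → ℝ) × ℝ, heisMul n a p (heisInv n q) ≠ (0, 0) →
        (mixedHess n a β p q).det
          = c * ((∑ i, (heisMul n a p (heisInv n q)).1 i ^ 2) ^ 2
                  + a ^ 2 * (heisMul n a p (heisInv n q)).2 ^ 2) ^ m₁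
              * ((∑ i, (heisMul n a p (heisInv n q)).1 i ^ 2) ^ 2
                  + (heisMul n a p (heisInv n q)).2 ^ 2) ^ m₂
              * fab n a β (heisMul n a p (heisInv n q)) := by

  refine ⟨-(β / 4) ^ (2 * n + 1) * 16 ^ n, by simp [hβ], (n - 1 : ℕ),
    (-β / 4 - 2) * (2 * n + 1 : ℕ) + (2 * n : ℕ), fun p q hpq => ?_⟩
  have h := koranyi_pos hpq
  rw [← det_submatrix_equiv_self finSumFinEquiv, mixedHess_submatrix n a β p q h, det_smul,
    det_mul, det_mul, det_fromBlocks_zero₂₁, det_fromBlocks_zero₁₂,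
    det_centralHess n hn a _ _ _ h ha]
  rw [heisMul_heisInv]
  have hs : ∑ i, (p.1 - q.1) i ^ 2 = (p.1 - q.1) ⬝ᵥ (p.1 - q.1) := by
    simp [dotProduct, sq]
  simp only [fab, hs]
  rw [← koranyi, Real.rpow_add h, Real.rpow_mul h.le, Real.rpow_natCast, Real.rpow_natCast,
    Real.rpow_natCast]
  simp only [det_one, Fintype.card_sum, Fintype.card_fin, neg_mul]
  rw [neg_div]
  ring

end
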